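/- arXiv:2402.04348 — 2 statements merged into one kernel-verified Lean document; each statement's English description precedes it below -/
import Mathlib

section
/- Let c₁, c₂, c₃, c₄ > 0, let m ≥ n ≥ 1 be integers, let ν be a positive measure in SMZ(m) with constants (c₁,c₂,c₃,c₄), and let q_0,…,q_{n−1} be functions with q_j ∈ Π_{j+1} that are orthonormal in L²(ν). Then there exist constants a₁, a₂, a₃ > 0, depending only on (c₁,c₂,c₃,c₄), such that for every x ∈ ℝ: a₁ Σ_{j=0}^{n−1} ψ_j(x)² ≤ Σ_{j=0}^{n−1} |q_j(x)|² ≤ a₂ Σ_{j=0}^{n−1} ψ_j(x)² ≤ a₃ n^{1/2}. -/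
open MeasureTheory Filter ENNReal ProbabilityTheory

noncomputable def psiH (k : ℕ) (x : ℝ) : ℝ :=
  (Real.sqrt Real.pi * 2 ^ k * (Nat.factorial k : ℝ)) ^ (-(1 : ℝ) / 2) * (-1 : ℝ) ^ k *
    Real.exp (x ^ 2 / 2) * iteratedDeriv k (fun t : ℝ => Real.exp (-t ^ 2)) x

noncomputable def PiH (n : ℕ) : Submodule ℝ (ℝ → ℝ) :=
  Submodule.span ℝ {f : ℝ → ℝ | ∃ k, k < n ∧ f = psiH k}

noncomputable def degApproxH (p : ℝ≥0∞) (n : ℕ) (f : ℝ → ℝ) : ℝ≥0∞ :=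
  ⨅ (P : ℝ → ℝ) (_ : P ∈ PiH n), eLpNorm (fun x => f x - P x) p volume

noncomputable def fourierT (f : ℝ → ℝ) (ω : ℝ) : ℂ :=
  (Real.sqrt (2 * Real.pi) : ℂ)⁻¹ * ∫ t : ℝ, (f t : ℂ) * Complex.exp (-(Complex.I * ω * t))

def SMZ (m : ℕ) (c₁ c₂ c₃ c₄ : ℝ) (ν : Measure ℝ) : Prop :=
  (∀ P ∈ PiH m,
      ENNReal.ofReal c₁ * (∫⁻ t : ℝ, ENNReal.ofReal (P t ^ 2)) ≤ (∫⁻ t, ENNReal.ofReal (P t ^ 2) ∂ν) ∧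
      (∫⁻ t, ENNReal.ofReal (P t ^ 2) ∂ν) ≤ ENNReal.ofReal c₂ * (∫⁻ t : ℝ, ENNReal.ofReal (P t ^ 2))) ∧
  ENNReal.ofReal (c₃ * Real.sqrt m) ≤ ν Set.univ ∧ ν Set.univ ≤ ENNReal.ofReal (c₄ * Real.sqrt m)

/-- Physicists' Hermite polynomials. -/
noncomputable def Hpoly : ℕ → Polynomial ℝ
  | 0 => 1
  | (k + 1) => 2 * Polynomial.X * Hpoly k - Polynomial.derivative (Hpoly k)

lemma Hpoly_succ (k : ℕ) :
    Hpoly (k + 1) = 2 * Polynomial.X * Hpoly k - Polynomial.derivative (Hpoly k) := rfl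

lemma Hpoly_deriv (k : ℕ) :
    Polynomial.derivative (Hpoly (k + 1)) = 2 * ((k : Polynomial ℝ) + 1) * Hpoly k := by
  induction k with
  | zero => simp [Hpoly]
  | succ k ih =>
    rw [Hpoly_succ (k + 1)]
    simp only [Polynomial.derivative_sub, Polynomial.derivative_mul, ih,
      Polynomial.derivative_X, Polynomial.derivative_ofNat, Polynomial.derivative_natCast,
      Polynomial.derivative_one, Polynomial.derivative_add]
    rw [Hpoly_succ k]
    push_cast
    ring

lemma iter_gauss (k : ℕ) :
    iteratedDeriv k (fun t : ℝ => Real.exp (-t ^ 2)) =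
      fun x => (-1 : ℝ) ^ k * (Hpoly k).eval x * Real.exp (-x ^ 2) := by
  induction k with
  | zero => ext x; simp [Hpoly]
  | succ k ih =>
    rw [iteratedDeriv_succ, ih]
    ext x
    have h1 : HasDerivAt (fun x : ℝ => Real.exp (-x ^ 2)) (Real.exp (-x ^ 2) * (-(2 * x))) x := by
      have := ((hasDerivAt_pow 2 x).neg).exp
      simpa using this
    have h2 := (((Hpoly k).hasDerivAt x).const_mul ((-1 : ℝ) ^ k)).mul h1
    have h3 := h2.deriv
    simp only [Pi.mul_def] at h3
    rw [h3, Hpoly_succ]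
    simp
    ring

/-- normalizing constant -/
noncomputable def Nrm (k : ℕ) : ℝ :=
  (Real.sqrt Real.pi * 2 ^ k * (Nat.factorial k : ℝ)) ^ (-(1 : ℝ) / 2)

lemma Nrm_eq (k : ℕ) : Nrm k = (Real.sqrt (Real.sqrt Real.pi * 2 ^ k * (Nat.factorial k : ℝ)))⁻¹ := by
  unfold Nrm
  rw [Real.sqrt_eq_rpow (_ * _ * _), ← Real.rpow_neg (by positivity)]
  norm_num

lemma Nrm_succ (k : ℕ) : Real.sqrt (2 * (k + 1)) * Nrm (k + 1) = Nrm k := by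
  rw [Nrm_eq, Nrm_eq]
  have : Real.sqrt Real.pi * 2 ^ (k + 1) * (Nat.factorial (k + 1) : ℝ)
      = (2 * (k + 1)) * (Real.sqrt Real.pi * 2 ^ k * (Nat.factorial k : ℝ)) := by
    rw [Nat.factorial_succ]; push_cast; ring
  rw [this, Real.sqrt_mul (x := 2 * ((k : ℝ) + 1)) (by positivity) (Real.sqrt Real.pi * 2 ^ k * (Nat.factorial k : ℝ)), mul_inv, ← mul_assoc, mul_inv_cancel₀, one_mul]
  positivity

lemma psiH_eq (k : ℕ) (x : ℝ) :
    psiH k x = Nrm k * ((Hpoly k).eval x * Real.exp (-x ^ 2 / 2)) := by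
  unfold psiH
  rw [iter_gauss]
  have h : Real.exp (-x ^ 2 / 2) = Real.exp (x ^ 2 / 2) * Real.exp (-x ^ 2) := by
    rw [← Real.exp_add]; congr 1; ring
  have h2 : ((-1 : ℝ) ^ k) * (-1 : ℝ) ^ k = 1 := by
    rw [← mul_pow]; simp
  rw [h]
  change Nrm k * _ * _ * _ = _
  linear_combination (Nrm k * (Hpoly k).eval x * (Real.exp (x ^ 2 / 2) * Real.exp (-x ^ 2))) * h2

lemma hasDerivAt_G (p : Polynomial ℝ) (x : ℝ) :
    HasDerivAt (fun x => p.eval x * Real.exp (-x ^ 2 / 2))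
      (p.derivative.eval x * Real.exp (-x ^ 2 / 2) - x * (p.eval x * Real.exp (-x ^ 2 / 2))) x := by
  have h1 : HasDerivAt (fun x : ℝ => Real.exp (-x ^ 2 / 2)) (Real.exp (-x ^ 2 / 2) * (-x)) x := by
    have h0 : HasDerivAt (fun x : ℝ => -x ^ 2 / 2) (-x) x := by
      refine HasDerivAt.congr_deriv (((hasDerivAt_pow 2 x).neg).div_const 2) ?_
      push_cast
      ring
    exact h0.exp
  have h2 := (p.hasDerivAt x).mul h1
  refine HasDerivAt.congr_deriv h2 ?_
  ring

/-- raising form -/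
lemma psiH_hasDerivAt (k : ℕ) (x : ℝ) :
    HasDerivAt (psiH k) (x * psiH k x - Real.sqrt (2 * (k + 1)) * psiH (k + 1) x) x := by
  have h := (hasDerivAt_G (Hpoly k) x).const_mul (Nrm k)
  have e : psiH k = fun x => Nrm k * ((Hpoly k).eval x * Real.exp (-x ^ 2 / 2)) := by
    ext x; exact psiH_eq k x
  rw [← e] at h
  refine h.congr_deriv ?_
  rw [psiH_eq k, psiH_eq (k + 1), ← Nrm_succ k, Hpoly_succ]
  simp
  ring

/-- lowering form -/
lemma psiH_hasDerivAt_zero (x : ℝ) : HasDerivAt (psiH 0) (- (x * psiH 0 x)) x := by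
  have h := (hasDerivAt_G (Hpoly 0) x).const_mul (Nrm 0)
  have e : psiH 0 = fun x => Nrm 0 * ((Hpoly 0).eval x * Real.exp (-x ^ 2 / 2)) := by
    ext x; exact psiH_eq 0 x
  rw [← e] at h
  refine h.congr_deriv ?_
  rw [psiH_eq 0]
  simp [Hpoly]
  ring

lemma psiH_hasDerivAt_succ (k : ℕ) (x : ℝ) :
    HasDerivAt (psiH (k + 1))
      (Real.sqrt (2 * (k + 1)) * psiH k x - x * psiH (k + 1) x) x := by
  have h := (hasDerivAt_G (Hpoly (k + 1)) x).const_mul (Nrm (k + 1))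
  have e : psiH (k + 1) = fun x => Nrm (k + 1) * ((Hpoly (k + 1)).eval x * Real.exp (-x ^ 2 / 2)) := by
    ext x; exact psiH_eq (k + 1) x
  rw [← e] at h
  refine h.congr_deriv ?_
  rw [psiH_eq k, psiH_eq (k + 1), ← Nrm_succ k, Hpoly_deriv]
  simp only [Polynomial.eval_mul, Polynomial.eval_add, Polynomial.eval_natCast,
    Polynomial.eval_one, Polynomial.eval_ofNat]
  have hs : Real.sqrt (2 * (k + 1)) * Real.sqrt (2 * (k + 1)) = 2 * ((k : ℝ) + 1) :=
    Real.mul_self_sqrt (by positivity)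
  linear_combination (-Nrm (k + 1) * (Hpoly k).eval x * Real.exp (-x ^ 2 / 2)) * hs

lemma psiH_continuous (k : ℕ) : Continuous (psiH k) :=
  continuous_iff_continuousAt.2 fun x => (psiH_hasDerivAt k x).continuousAt

lemma integrable_poly_gauss (p : Polynomial ℝ) :
    Integrable (fun x : ℝ => p.eval x * Real.exp (-x ^ 2)) := by
  induction p using Polynomial.induction_on' with
  | add p q hp hq =>
    simp only [Polynomial.eval_add, add_mul]
    exact hp.add hq
  | monomial n a =>
    have h := integrable_rpow_mul_exp_neg_mul_sq (b := 1) one_pos (s := n)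
      (by have : (0 : ℝ) ≤ n := n.cast_nonneg
          linarith)
    have h2 := h.const_mul a
    refine h2.congr (ae_of_all _ fun x => ?_)
    simp [mul_assoc]

lemma gauss_sq (x : ℝ) : Real.exp (-x ^ 2 / 2) * Real.exp (-x ^ 2 / 2) = Real.exp (-x ^ 2) := by
  rw [← Real.exp_add]; congr 1; ring

lemma psiH_mul_eq (i j : ℕ) (x : ℝ) :
    psiH i x * psiH j x = Nrm i * Nrm j * ((Hpoly i * Hpoly j).eval x * Real.exp (-x ^ 2)) := by
  rw [psiH_eq, psiH_eq, ← gauss_sq, Polynomial.eval_mul]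
  ring

lemma psiH_mul_integrable (i j : ℕ) : Integrable (fun x => psiH i x * psiH j x) := by
  simp only [psiH_mul_eq]
  exact (integrable_poly_gauss _).const_mul _

lemma psiH_inner_rec (i j : ℕ) :
    Real.sqrt (2 * (i + 1)) * ∫ x, psiH (i + 1) x * psiH (j + 1) x
      = Real.sqrt (2 * (j + 1)) * ∫ x, psiH i x * psiH j x := by
  have hd : ∀ x, HasDerivAt (fun x => psiH i x * psiH (j + 1) x)
      (Real.sqrt (2 * (j + 1)) * (psiH i x * psiH j x)
        - Real.sqrt (2 * (i + 1)) * (psiH (i + 1) x * psiH (j + 1) x)) x := by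
    intro x
    refine HasDerivAt.congr_deriv ((psiH_hasDerivAt i x).mul (psiH_hasDerivAt_succ j x)) ?_
    ring
  have h1 := (psiH_mul_integrable i j).const_mul (Real.sqrt (2 * (j + 1)))
  have h2 := (psiH_mul_integrable (i + 1) (j + 1)).const_mul (Real.sqrt (2 * (i + 1)))
  have h := integral_eq_zero_of_hasDerivAt_of_integrable hd (h1.sub h2)
    (psiH_mul_integrable i (j + 1))
  rw [integral_sub h1 h2, integral_const_mul, integral_const_mul] at h
  linarith

lemma psiH_inner_zero (i : ℕ) : ∫ x, psiH (i + 1) x * psiH 0 x = 0 := by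
  have hd : ∀ x, HasDerivAt (fun x => psiH i x * psiH 0 x)
      (- Real.sqrt (2 * (i + 1)) * (psiH (i + 1) x * psiH 0 x)) x := by
    intro x
    refine HasDerivAt.congr_deriv ((psiH_hasDerivAt i x).mul (psiH_hasDerivAt_zero x)) ?_
    ring
  have h2 := (psiH_mul_integrable (i + 1) 0).const_mul (- Real.sqrt (2 * (i + 1)))
  have h := integral_eq_zero_of_hasDerivAt_of_integrable hd h2 (psiH_mul_integrable i 0)
  rw [integral_const_mul] at h
  have : - Real.sqrt (2 * (i + 1)) ≠ 0 := by
    have : 0 < Real.sqrt (2 * ((i : ℝ) + 1)) := by positivity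
    linarith
  exact (mul_eq_zero.1 h).resolve_left this

lemma psiH_inner_zero_zero : ∫ x, psiH 0 x * psiH 0 x = 1 := by
  simp only [psiH_mul_eq]
  rw [integral_const_mul]
  have h := integral_gaussian 1
  simp only [Hpoly, mul_one, Polynomial.eval_one, one_mul]
  simp only [neg_mul, one_mul, div_one] at h
  rw [h, Nrm_eq]
  have hp : 0 < Real.sqrt Real.pi := by positivity
  simp only [pow_zero, mul_one, Nat.factorial_zero, Nat.cast_one]
  rw [← mul_inv, Real.mul_self_sqrt hp.le, inv_mul_cancel₀ hp.ne']

lemma psiH_ortho (i j : ℕ) : ∫ x, psiH i x * psiH j x = if i = j then 1 else 0 := by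
  induction i generalizing j with
  | zero =>
    cases j with
    | zero => simpa using psiH_inner_zero_zero
    | succ j =>
      simp only [mul_comm (psiH 0 _)]
      rw [psiH_inner_zero]; simp
  | succ i ih =>
    cases j with
    | zero => rw [psiH_inner_zero]; simp
    | succ j =>
      have h := psiH_inner_rec i j
      rw [ih] at h
      have hp : Real.sqrt (2 * ((i : ℝ) + 1)) ≠ 0 := by positivity
      by_cases hij : i = j
      · subst hij
        simp only [if_true] at h ⊢
        exact mul_left_cancel₀ hp h
      · rw [if_neg hij, mul_zero] at h
        rw [if_neg (by omega)]
        exact (mul_eq_zero.1 h).resolve_left hp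

lemma K_hasDerivAt (n : ℕ) (x : ℝ) :
    HasDerivAt (fun x => ∑ j ∈ Finset.range (n + 1), psiH j x ^ 2)
      (- Real.sqrt (2 * (n + 1)) * (psiH n x * psiH (n + 1) x)) x := by
  induction n with
  | zero =>
    simp only [zero_add, Finset.range_one, Finset.sum_singleton, pow_two]
    have h1 := psiH_hasDerivAt_zero x
    have h2 := psiH_hasDerivAt 0 x
    refine HasDerivAt.congr_deriv (h1.mul h2) ?_
    simp only [zero_add]
    ring
  | succ n ih =>
    simp only [Finset.sum_range_succ _ (n + 1), pow_two (psiH (n + 1) _)]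
    have h2 := (psiH_hasDerivAt (n + 1) x).mul (psiH_hasDerivAt_succ n x)
    have h3 := ih.add h2
    refine HasDerivAt.congr_deriv h3 ?_
    push_cast; ring

lemma K_bound (n : ℕ) (hn : 1 ≤ n) (x : ℝ) :
    ∑ j ∈ Finset.range n, psiH j x ^ 2 ≤ Real.sqrt 2 * Real.sqrt n := by
  obtain ⟨n, rfl⟩ : ∃ k, n = k + 1 := ⟨n - 1, by omega⟩
  set s := Real.sqrt (2 * ((n : ℝ) + 1)) with hs
  have hs0 : 0 ≤ s := Real.sqrt_nonneg _
  have hI : Integrable (fun x => - s * (psiH n x * psiH (n + 1) x)) :=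
    (psiH_mul_integrable n (n + 1)).const_mul _
  have hK : Integrable (fun x => ∑ j ∈ Finset.range (n + 1), psiH j x ^ 2) := by
    refine integrable_finsetSum _ fun j _ => ?_
    simpa [pow_two] using psiH_mul_integrable j j
  have ht := tendsto_zero_of_hasDerivAt_of_integrableOn_Ioi (a := x)
    (fun y _ => K_hasDerivAt n y) hI.integrableOn hK.integrableOn
  have h := integral_Ioi_of_hasDerivAt_of_tendsto' (a := x)
    (fun y _ => K_hasDerivAt n y) hI.integrableOn ht
  have hB : Integrable (fun x => s / 2 * (psiH n x * psiH n x + psiH (n + 1) x * psiH (n + 1) x)) :=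
    ((psiH_mul_integrable n n).add (psiH_mul_integrable (n + 1) (n + 1))).const_mul _
  have hBv : ∫ x, s / 2 * (psiH n x * psiH n x + psiH (n + 1) x * psiH (n + 1) x) = s := by
    rw [integral_const_mul, integral_add (psiH_mul_integrable n n)
      (psiH_mul_integrable (n + 1) (n + 1)), psiH_ortho, psiH_ortho]
    simp; ring
  have h1 : ∫ y in Set.Ioi x, -(- s * (psiH n y * psiH (n + 1) y)) ≤
      ∫ y in Set.Ioi x, s / 2 * (psiH n y * psiH n y + psiH (n + 1) y * psiH (n + 1) y) := by
    refine setIntegral_mono hI.neg.integrableOn hB.integrableOn fun y => ?_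
    nlinarith [mul_nonneg hs0 (sq_nonneg (psiH n y - psiH (n + 1) y))]
  have h2 : ∫ y in Set.Ioi x, s / 2 * (psiH n y * psiH n y + psiH (n + 1) y * psiH (n + 1) y) ≤ s := by
    refine le_of_le_of_eq ?_ hBv
    refine setIntegral_le_integral hB (ae_of_all _ fun y => ?_)
    have := mul_self_nonneg (psiH n y)
    have := mul_self_nonneg (psiH (n + 1) y)
    dsimp
    positivity
  rw [integral_neg, h] at h1
  rw [← Real.sqrt_mul (by norm_num)]
  push_cast
  rw [← hs]
  linarith

lemma PiH_mono {k n : ℕ} (h : k ≤ n) : PiH k ≤ PiH n := by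
  refine Submodule.span_mono ?_
  rintro f ⟨j, hj, rfl⟩
  exact ⟨j, hj.trans_le h, rfl⟩

lemma PiH_eq (n : ℕ) : PiH n = Submodule.span ℝ (Set.range fun k : Fin n => psiH k) := by
  unfold PiH
  congr 1
  ext f
  constructor
  · rintro ⟨k, hk, rfl⟩; exact ⟨⟨k, hk⟩, rfl⟩
  · rintro ⟨k, rfl⟩; exact ⟨k, k.2, rfl⟩

lemma PiH_rep {n : ℕ} {P : ℝ → ℝ} (h : P ∈ PiH n) :
    ∃ b : Fin n → ℝ, ∀ x, P x = ∑ k, b k * psiH k x := by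
  rw [PiH_eq, Submodule.mem_span_range_iff_exists_fun] at h
  obtain ⟨b, rfl⟩ := h
  exact ⟨b, fun x => by simp⟩

lemma ortho_sq {n : ℕ} (μ : Measure ℝ) (f : Fin n → ℝ → ℝ)
    (hi : ∀ i j, Integrable (fun x => f i x * f j x) μ)
    (ho : ∀ i j, ∫ x, f i x * f j x ∂μ = if i = j then 1 else 0) (b : Fin n → ℝ) :
    Integrable (fun x => (∑ k, b k * f k x) ^ 2) μ ∧
    ∫ x, (∑ k, b k * f k x) ^ 2 ∂μ = ∑ k, b k ^ 2 := by
  have e : ∀ x, (∑ k, b k * f k x) ^ 2 = ∑ i, ∑ j, b i * b j * (f i x * f j x) := by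
    intro x
    rw [pow_two, Finset.sum_mul_sum]
    refine Finset.sum_congr rfl fun i _ => Finset.sum_congr rfl fun j _ => by ring
  simp only [e]
  have h1 : ∀ i j, Integrable (fun x => b i * b j * (f i x * f j x)) μ :=
    fun i j => (hi i j).const_mul _
  have h2 : ∀ i, Integrable (fun x => ∑ j, b i * b j * (f i x * f j x)) μ :=
    fun i => integrable_finsetSum _ fun j _ => h1 i j
  refine ⟨integrable_finsetSum _ fun i _ => h2 i, ?_⟩
  rw [integral_finsetSum _ fun i _ => h2 i]
  refine Finset.sum_congr rfl fun i _ => ?_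
  rw [integral_finsetSum _ fun j _ => h1 i j]
  simp [integral_const_mul, ho, pow_two]

lemma psiH_sq {n : ℕ} (b : Fin n → ℝ) :
    Integrable (fun x => (∑ k, b k * psiH k x) ^ 2) ∧
    ∫ x, (∑ k, b k * psiH k x) ^ 2 = ∑ k, b k ^ 2 :=
  ortho_sq volume (fun k : Fin n => psiH k) (fun i j => psiH_mul_integrable i j)
    (fun i j => by rw [psiH_ortho]; simp [Fin.ext_iff]) b

lemma PiH_cont {n : ℕ} {P : ℝ → ℝ} (h : P ∈ PiH n) : Continuous P := by
  obtain ⟨b, hb⟩ := PiH_rep h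
  rw [funext hb]
  exact continuous_finsetSum _ fun k _ => continuous_const.mul (psiH_continuous k)

lemma PiH_int {n : ℕ} {P : ℝ → ℝ} (h : P ∈ PiH n) : Integrable (fun x => P x ^ 2) := by
  obtain ⟨b, hb⟩ := PiH_rep h
  simp only [hb]
  exact (psiH_sq b).1

lemma SMZ_int {m : ℕ} {c₁ c₂ c₃ c₄ : ℝ} (h₁ : 0 < c₁) (h₂ : 0 < c₂) {ν : Measure ℝ}
    (h : SMZ m c₁ c₂ c₃ c₄ ν) {P : ℝ → ℝ} (hP : P ∈ PiH m) :
    Integrable (fun x => P x ^ 2) ν ∧ c₁ * ∫ x, P x ^ 2 ≤ ∫ x, P x ^ 2 ∂ν ∧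
      ∫ x, P x ^ 2 ∂ν ≤ c₂ * ∫ x, P x ^ 2 := by
  obtain ⟨ha, hb⟩ := h.1 P hP
  have hv := PiH_int hP
  have ev := ofReal_integral_eq_lintegral_ofReal hv (ae_of_all _ fun x => sq_nonneg (P x))
  have hfin : (∫⁻ t, ENNReal.ofReal (P t ^ 2) ∂ν) < ⊤ := by
    refine hb.trans_lt ?_
    rw [← ev]
    exact ENNReal.mul_lt_top ENNReal.ofReal_lt_top ENNReal.ofReal_lt_top
  have hn : Integrable (fun x => P x ^ 2) ν := by
    refine ⟨((PiH_cont hP).pow 2).aestronglyMeasurable, ?_⟩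
    rw [hasFiniteIntegral_iff_ofReal (ae_of_all _ fun x => sq_nonneg (P x))]
    exact hfin
  have en := ofReal_integral_eq_lintegral_ofReal hn (ae_of_all _ fun x => sq_nonneg (P x))
  have p1 : 0 ≤ ∫ x, P x ^ 2 := integral_nonneg fun x => sq_nonneg _
  have p2 : 0 ≤ ∫ x, P x ^ 2 ∂ν := integral_nonneg fun x => sq_nonneg _
  rw [← ev, ← en, ← ENNReal.ofReal_mul h₁.le, ENNReal.ofReal_le_ofReal_iff p2] at ha
  rw [← ev, ← en, ← ENNReal.ofReal_mul h₂.le, ENNReal.ofReal_le_ofReal_iff (by positivity)] at hb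
  exact ⟨hn, ha, hb⟩

lemma kernel_aux {A B S c : ℝ} (hc : 0 ≤ c) (hA : 0 ≤ A) (hB : 0 ≤ B) (h1 : A ^ 2 ≤ S * B)
    (h2 : S ≤ c * A) : A ≤ c * B := by
  rcases hA.eq_or_lt with h | h
  · rw [← h]; positivity
  · have : A * A ≤ A * (c * B) := by nlinarith
    exact le_of_mul_le_mul_left this h

theorem stmt12 (c₁ c₂ c₃ c₄ : ℝ) (h₁ : 0 < c₁) (h₂ : 0 < c₂) (h₃ : 0 < c₃) (h₄ : 0 < c₄) :
    ∃ a₁ : ℝ, 0 < a₁ ∧ ∃ a₂ : ℝ, 0 < a₂ ∧ ∃ a₃ : ℝ, 0 < a₃ ∧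
      ∀ (m n : ℕ), 1 ≤ n → n ≤ m →
      ∀ (ν : Measure ℝ), SMZ m c₁ c₂ c₃ c₄ ν →
      ∀ (q : Fin n → ℝ → ℝ), (∀ j : Fin n, q j ∈ PiH (j + 1)) →
        (∀ i j : Fin n, (∫ x, q i x * q j x ∂ν) = if i = j then 1 else 0) →
      ∀ x : ℝ,
        a₁ * ∑ j ∈ Finset.range n, psiH j x ^ 2 ≤ ∑ j : Fin n, q j x ^ 2 ∧
        ∑ j : Fin n, q j x ^ 2 ≤ a₂ * ∑ j ∈ Finset.range n, psiH j x ^ 2 ∧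
        a₂ * ∑ j ∈ Finset.range n, psiH j x ^ 2 ≤ a₃ * Real.sqrt n := by
  refine ⟨c₂⁻¹, by positivity, c₁⁻¹, by positivity, c₁⁻¹ * Real.sqrt 2, by positivity, ?_⟩
  intro m n hn hnm ν hν q hq ho x
  have hqn : ∀ j, q j ∈ PiH n := fun j => PiH_mono (by omega) (hq j)
  have hqm : ∀ j, q j ∈ PiH m := fun j => PiH_mono hnm (hqn j)
  have hqi : ∀ i j, Integrable (fun x => q i x * q j x) ν := by
    intro i j
    refine ((SMZ_int h₁ h₂ hν (hqm i)).1.add (SMZ_int h₁ h₂ hν (hqm j)).1).mono'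
      ((PiH_cont (hqm i)).mul (PiH_cont (hqm j))).aestronglyMeasurable (ae_of_all _ fun y => ?_)
    simp only [Pi.add_apply, Real.norm_eq_abs]
    rw [abs_le]
    constructor <;> nlinarith [sq_nonneg (q i y - q j y), sq_nonneg (q i y + q j y),
      sq_nonneg (q i y), sq_nonneg (q j y)]
  have hsq := ortho_sq ν q hqi ho
  have hspan : Submodule.span ℝ (Set.range q) = PiH n := by
    have hli : LinearIndependent ℝ q := by
      rw [Fintype.linearIndependent_iff]
      intro g hg
      have h0 := (hsq g).2
      have : ∀ y, ∑ k, g k * q k y = 0 := fun y => by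
        have := congrFun hg y
        simpa using this
      simp only [this] at h0
      intro i
      have h3 : ∑ k, g k ^ 2 = 0 := by rw [← h0]; simp
      have := (Finset.sum_eq_zero_iff_of_nonneg (fun k _ => sq_nonneg (g k))).1 h3 i
        (Finset.mem_univ i)
      exact pow_eq_zero_iff (two_ne_zero) |>.1 this
    have hle : Submodule.span ℝ (Set.range q) ≤ PiH n := by
      rw [Submodule.span_le]
      rintro _ ⟨j, rfl⟩
      exact hqn j
    have : FiniteDimensional ℝ (PiH n) := by
      rw [PiH_eq]; exact FiniteDimensional.span_of_finite ℝ (Set.finite_range _)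
    refine Submodule.eq_of_le_of_finrank_le hle ?_
    rw [finrank_span_eq_card hli, PiH_eq]
    exact finrank_range_le_card _
  have hKpsi : ∑ j ∈ Finset.range n, psiH j x ^ 2 = ∑ j : Fin n, psiH j x ^ 2 :=
    (Fin.sum_univ_eq_sum_range (fun j => psiH j x ^ 2) n).symm
  have hKp : 0 ≤ ∑ j : Fin n, psiH j x ^ 2 := Finset.sum_nonneg fun _ _ => sq_nonneg _
  have hKq : 0 ≤ ∑ j : Fin n, q j x ^ 2 := Finset.sum_nonneg fun _ _ => sq_nonneg _
  refine ⟨?_, ?_, ?_⟩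
  · rw [hKpsi, inv_mul_le_iff₀ h₂]
    set P : ℝ → ℝ := fun y => ∑ k : Fin n, psiH k x * psiH k y with hPdef
    have hP : P ∈ PiH n := by
      rw [PiH_eq, Submodule.mem_span_range_iff_exists_fun]
      exact ⟨fun k => psiH k x, by ext y; simp [hPdef]⟩
    have hPi := (SMZ_int h₁ h₂ hν (PiH_mono hnm hP)).2.2
    have hP2 : ∫ y, P y ^ 2 = ∑ k : Fin n, psiH k x ^ 2 := (psiH_sq fun k : Fin n => psiH k x).2
    have hP' := hP
    rw [← hspan, Submodule.mem_span_range_iff_exists_fun] at hP'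
    obtain ⟨b, hb⟩ := hP'
    have hb' : ∀ y, P y = ∑ k, b k * q k y := fun y => by rw [← hb]; simp
    have hPx : P x = ∑ k : Fin n, psiH k x ^ 2 := by simp [hPdef, pow_two]
    have hS : ∫ y, P y ^ 2 ∂ν = ∑ k, b k ^ 2 := by simp only [hb']; exact (hsq b).2
    rw [hS, hP2] at hPi
    refine kernel_aux h₂.le hKp hKq ?_ hPi
    rw [← hPx, hb' x]
    exact Finset.sum_mul_sq_le_sq_mul_sq _ _ _
  · rw [hKpsi]
    set P : ℝ → ℝ := fun y => ∑ k : Fin n, q k x * q k y with hPdef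
    have hP : P ∈ PiH n := by
      rw [← hspan, Submodule.mem_span_range_iff_exists_fun]
      exact ⟨fun k => q k x, by ext y; simp [hPdef]⟩
    have hPi := (SMZ_int h₁ h₂ hν (PiH_mono hnm hP)).2.1
    have hP2 : ∫ y, P y ^ 2 ∂ν = ∑ k : Fin n, q k x ^ 2 := (hsq fun k : Fin n => q k x).2
    obtain ⟨b, hb'⟩ := PiH_rep hP
    have hPx : P x = ∑ k : Fin n, q k x ^ 2 := by simp [hPdef, pow_two]
    have hS : ∫ y, P y ^ 2 = ∑ k, b k ^ 2 := by simp only [hb']; exact (psiH_sq b).2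
    rw [hS, hP2, ← le_inv_mul_iff₀ h₁] at hPi
    refine kernel_aux (inv_pos.2 h₁).le hKq hKp ?_ hPi
    rw [← hPx, hb' x]
    exact Finset.sum_mul_sq_le_sq_mul_sq _ _ _
  · rw [mul_assoc]
    exact mul_le_mul_of_nonneg_left (K_bound n hn x) (by positivity)
end

section
/- There exists a constant c > 0 such that for every integer n ≥ 1 and every weighted polynomial P ∈ Π_n, the Nikolskii inequalities ‖P‖_1 ≤ c n^{1/2} ‖P‖_∞ and n^{1/2} ‖P‖_∞ ≤ c n ‖P‖_1 hold. -/
open MeasureTheory Filter ENNReal ProbabilityTheory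

namespace Nik

noncomputable def g (k : ℕ) : ℝ → ℝ := iteratedDeriv k (fun t : ℝ => Real.exp (-t ^ 2))

noncomputable def c (k : ℕ) : ℝ :=
  (Real.sqrt Real.pi * 2 ^ k * (Nat.factorial k : ℝ)) ^ (-(1 : ℝ) / 2)

noncomputable def be (k : ℕ) : ℝ := Real.sqrt (2 * k)

lemma g_deriv (k : ℕ) (x : ℝ) : HasDerivAt (g k) (g (k+1) x) x := by
  have h : ContDiff ℝ ((k+1 : ℕ) : ℕ∞) (fun t : ℝ => Real.exp (-t ^ 2)) := by fun_prop
  have h2 : Differentiable ℝ (g k) :=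
    h.differentiable_iteratedDeriv k (by exact_mod_cast Nat.lt_succ_self k)
  have := (h2 x).hasDerivAt
  have e : g (k+1) = deriv (g k) := by
    unfold g; rw [iteratedDeriv_succ]
  rw [e]; exact this

lemma g_zero (x : ℝ) : g 0 x = Real.exp (-x^2) := by simp [g]

lemma g_three (k : ℕ) : ∀ x : ℝ, g (k+1) x = -2 * x * g k x - 2 * k * g (k-1) x := by
  induction k with
  | zero =>
    intro x
    have h1 := g_deriv 0 x
    have h2 : HasDerivAt (g 0) (Real.exp (-x^2) * (-(2 * x))) x := by
      have : g 0 = fun x => Real.exp (-x^2) := by funext y; exact g_zero y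
      rw [this]
      have := ((hasDerivAt_pow 2 x).neg).exp
      simpa using this
    rw [h1.unique h2, g_zero]; simp; ring
  | succ k ih =>
    intro x
    have h1 := g_deriv (k+1) x
    have e : g (k+1) = fun x => -2 * x * g k x - 2 * k * g (k-1) x := funext ih
    have h2 : HasDerivAt (fun x => -2 * x * g k x - 2 * k * g (k-1) x)
        ((-2) * g k x + (-2 * x) * g (k+1) x - 2 * k * g (k-1+1) x) x := by
      have := (((hasDerivAt_id x).const_mul (-2)).mul (g_deriv k x)).sub
        ((g_deriv (k-1) x).const_mul (2 * (k:ℝ)))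
      refine this.congr_deriv ?_
      simp
    rw [e] at h1
    have h3 := h1.unique h2
    rw [h3]
    rcases k with _ | k
    · simp; ring
    · simp; ring

lemma g_poly (k : ℕ) : ∃ p : Polynomial ℝ, ∀ x, g k x = p.eval x * Real.exp (-x^2) := by
  induction k using Nat.twoStepInduction with
  | zero => exact ⟨1, fun x => by simp [g_zero]⟩
  | one => exact ⟨-2 * Polynomial.X, fun x => by
      have := g_three 0 x
      simp [g_zero] at this ⊢; exact this⟩
  | more k h1 h2 =>
    obtain ⟨p, hp⟩ := h1
    obtain ⟨q, hq⟩ := h2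
    refine ⟨Polynomial.C (-2) * Polynomial.X * q - Polynomial.C (2 * ((k:ℝ)+1)) * p, fun x => ?_⟩
    rw [g_three (k+1) x]
    simp [hp, hq]; ring

lemma be_sq (k : ℕ) : be k * be k = 2 * k := Real.mul_self_sqrt (by positivity)

lemma be_pos (k : ℕ) : 0 < be (k+1) := by unfold be; positivity

lemma be_zero : be 0 = 0 := by simp [be]

lemma c_succ (k : ℕ) : c k = c (k+1) * be (k+1) := by
  unfold c be
  have : Real.sqrt Real.pi * 2 ^ (k+1) * ((k+1).factorial : ℝ) =
    (Real.sqrt Real.pi * 2 ^ k * (Nat.factorial k : ℝ)) * (2 * (k+1 : ℕ)) := by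
    rw [Nat.factorial_succ]; push_cast; ring
  have hp : (0:ℝ) < 2 * (k+1 : ℕ) := by positivity
  have e : (2 * ((k+1 : ℕ) : ℝ)) ^ (-(1 : ℝ) / 2) * Real.sqrt (2 * (k+1 : ℕ)) = 1 := by
    rw [Real.sqrt_eq_rpow, ← Real.rpow_add hp]
    norm_num
  rw [this, Real.mul_rpow (by positivity) hp.le]
  rw [mul_assoc (_ ^ _), e, mul_one]

lemma psi_eq (k : ℕ) (x : ℝ) : psiH k x = c k * (-1)^k * Real.exp (x^2/2) * g k x := rfl

lemma psi_deriv0 (k : ℕ) (x : ℝ) :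
    HasDerivAt (psiH k) (x * psiH k x - be (k+1) * psiH (k+1) x) x := by
  have h : HasDerivAt (fun x : ℝ => Real.exp (x^2/2)) (Real.exp (x^2/2) * x) x := by
    have := ((hasDerivAt_pow 2 x).div_const 2).exp
    simpa using this
  have := (h.const_mul (c k * (-1)^k)).mul (g_deriv k x)
  refine HasDerivAt.congr_deriv (f := psiH k) this ?_
  rw [psi_eq, psi_eq, c_succ k]; ring

lemma psi_x (k : ℕ) (x : ℝ) :
    x * psiH k x = be k / 2 * psiH (k-1) x + be (k+1) / 2 * psiH (k+1) x := by
  rw [psi_eq, psi_eq, psi_eq, g_three k x]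
  rcases k with _ | j
  · rw [c_succ 0, be_zero]; simp; ring
  · simp only [Nat.add_sub_cancel]
    rw [c_succ j, c_succ (j+1)]
    have := be_sq (j+1)
    push_cast at this ⊢
    have e : (2 * ((j:ℝ)+1)) = be (j+1) * be (j+1) := this.symm
    rw [e]
    ring

lemma psi_deriv (k : ℕ) (x : ℝ) :
    HasDerivAt (psiH k) (be k / 2 * psiH (k-1) x - be (k+1) / 2 * psiH (k+1) x) x := by
  convert psi_deriv0 k x using 1
  rw [psi_x]; ring

def PG (f : ℝ → ℝ) : Prop := ∃ p : Polynomial ℝ, ∀ x, f x = p.eval x * Real.exp (-x^2/2)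

lemma psi_PG (k : ℕ) : PG (psiH k) := by
  obtain ⟨p, hp⟩ := g_poly k
  refine ⟨Polynomial.C (c k * (-1)^k) * p, fun x => ?_⟩
  rw [psi_eq, hp]
  have : Real.exp (-x^2/2) = Real.exp (x^2/2) * Real.exp (-x^2) := by
    rw [← Real.exp_add]; ring_nf
  rw [this]; simp; ring

lemma int_poly (b : ℝ) (hb : 0 < b) (p : Polynomial ℝ) :
    Integrable (fun x : ℝ => p.eval x * Real.exp (-b * x^2)) := by
  induction p using Polynomial.induction_on' with
  | add p q hp hq => 
    have := hp.add hq
    refine this.congr (Eventually.of_forall fun x => ?_)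
    simp [add_mul]
  | monomial n a =>
    have h := integrable_rpow_mul_exp_neg_mul_sq hb (s := n) (by
      have : (0:ℝ) ≤ n := Nat.cast_nonneg n
      linarith)
    simpa [mul_assoc] using h.const_mul a

lemma PG.cont {f : ℝ → ℝ} (hf : PG f) : Continuous f := by
  obtain ⟨p, hp⟩ := hf
  have : f = fun x => p.eval x * Real.exp (-x^2/2) := funext hp
  rw [this]; fun_prop

lemma PG.int {f : ℝ → ℝ} (hf : PG f) : Integrable f := by
  obtain ⟨p, hp⟩ := hf
  have : f = fun x => p.eval x * Real.exp (-(1/2) * x^2) := by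
    funext x; rw [hp]; ring_nf
  rw [this]; exact int_poly _ (by norm_num) p

lemma PG.int_mul {f h : ℝ → ℝ} (hf : PG f) (hh : PG h) : Integrable (fun x => f x * h x) := by
  obtain ⟨p, hp⟩ := hf
  obtain ⟨q, hq⟩ := hh
  have : (fun x => f x * h x) = fun x => (p * q).eval x * Real.exp (-1 * x^2) := by
    funext x; rw [hp, hq]
    have : Real.exp (-1 * x^2) = Real.exp (-x^2/2) * Real.exp (-x^2/2) := by
      rw [← Real.exp_add]; ring_nf
    rw [this]; simp; ring
  rw [this]; exact int_poly _ (by norm_num) _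

lemma PG.xmul {f : ℝ → ℝ} (hf : PG f) : PG (fun x => x * f x) := by
  obtain ⟨p, hp⟩ := hf
  exact ⟨Polynomial.X * p, fun x => by simp [hp]; ring⟩

lemma PG.sum (n : ℕ) (b : ℕ → ℝ) (e : ℕ → ℕ) :
    PG (fun x => ∑ k ∈ Finset.range n, b k * psiH (e k) x) := by
  choose p hp using psi_PG
  refine ⟨∑ k ∈ Finset.range n, Polynomial.C (b k) * p (e k), fun x => ?_⟩
  rw [Polynomial.eval_finsetSum, Finset.sum_mul]
  refine Finset.sum_congr rfl fun k _ => ?_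
  rw [hp]; simp; ring

noncomputable def G (j k : ℕ) : ℝ := ∫ x, psiH j x * psiH k x

lemma G_int (j k : ℕ) : Integrable (fun x => psiH j x * psiH k x) := (psi_PG j).int_mul (psi_PG k)

lemma G_symm (j k : ℕ) : G j k = G k j := by
  unfold G; congr 1; funext x; ring

lemma G_rec (j k : ℕ) : be (k+1) * G j (k+1) = be j * G (j-1) k := by
  have h := integral_eq_zero_of_hasDerivAt_of_integrable
    (f := fun x => psiH j x * psiH k x)
    (f' := fun x => be j * (psiH (j-1) x * psiH k x) - be (k+1) * (psiH j x * psiH (k+1) x))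
    (fun x => by
      refine ((psi_deriv j x).mul (psi_deriv k x)).congr_deriv ?_
      have h1 := psi_x j x
      have h2 := psi_x k x
      linear_combination psiH k x * h1 - psiH j x * h2)
    (((G_int _ _).const_mul _).sub ((G_int _ _).const_mul _)) (G_int _ _)
  rw [integral_sub ((G_int _ _).const_mul _) ((G_int _ _).const_mul _), integral_const_mul,
    integral_const_mul] at h
  unfold G; linarith

lemma G_zero : G 0 0 = 1 := by
  have : (fun x => psiH 0 x * psiH 0 x) = fun x => (Real.sqrt Real.pi)⁻¹ * Real.exp (-1 * x^2) := by
    funext x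
    have e : Real.exp (x^2/2) * Real.exp (x^2/2) * (Real.exp (-x^2) * Real.exp (-x^2))
        = Real.exp (-1 * x^2) := by
      rw [← Real.exp_add, ← Real.exp_add, ← Real.exp_add]; ring_nf
    have e2 : c 0 * c 0 = (Real.sqrt Real.pi)⁻¹ := by
      unfold c
      rw [← Real.rpow_add (by positivity)]
      norm_num
      rw [Real.rpow_neg_one]
    rw [psi_eq, g_zero, ← e, ← e2]; ring
  unfold G
  rw [this, integral_const_mul, integral_gaussian]
  simp
  exact inv_mul_cancel₀ (by positivity)

lemma G_eq (j : ℕ) : ∀ k, G j k = if j = k then 1 else 0 := by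
  have h0 : ∀ k, G 0 (k+1) = 0 := fun k => by
    have := G_rec 0 k
    rw [be_zero, zero_mul] at this
    exact (mul_eq_zero.mp this).resolve_left (be_pos k).ne'
  induction j with
  | zero =>
    intro k
    rcases k with _ | k
    · simp [G_zero]
    · simp [h0]
  | succ j ih =>
    intro k
    rcases k with _ | k
    · rw [G_symm, h0]; simp
    · have := G_rec (j+1) k
      simp only [Nat.add_sub_cancel, ih] at this
      by_cases h : j = k
      · subst h
        simp at this ⊢
        exact mul_left_cancel₀ (be_pos j).ne' (by rw [this, mul_one])
      · simp [h] at this ⊢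
        exact this.resolve_left (be_pos k).ne'

lemma int_sum_sq (n s : ℕ) (b : ℕ → ℝ) :
    ∫ x, (∑ k ∈ Finset.range n, b k * psiH (k+s) x)^2 = ∑ k ∈ Finset.range n, b k ^ 2 := by
  have : (fun x => (∑ k ∈ Finset.range n, b k * psiH (k+s) x)^2) = fun x =>
      ∑ j ∈ Finset.range n, ∑ k ∈ Finset.range n,
        (b j * b k) * (psiH (j+s) x * psiH (k+s) x) := by
    funext x
    rw [sq, Finset.sum_mul_sum]
    refine Finset.sum_congr rfl fun j _ => Finset.sum_congr rfl fun k _ => by ring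
  rw [this, integral_finsetSum _ fun j _ => integrable_finsetSum _ fun k _ =>
    (G_int _ _).const_mul _]
  refine Finset.sum_congr rfl fun j hj => ?_
  rw [integral_finsetSum _ fun k _ => (G_int _ _).const_mul _]
  have : ∀ k ∈ Finset.range n, ∫ x, (b j * b k) * (psiH (j+s) x * psiH (k+s) x) =
      if j = k then b j ^ 2 else 0 := by
    intro k _
    rw [integral_const_mul]
    have := G_eq (j+s) (k+s)
    unfold G at this
    rw [this]
    by_cases h : j = k
    · subst h; simp; ring
    · simp [h]
  rw [Finset.sum_congr rfl this]
  simp at hj ⊢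
  omega

/-- The diagonal of the reproducing kernel. -/
noncomputable def K (n : ℕ) (x : ℝ) : ℝ := ∑ k ∈ Finset.range n, psiH k x ^ 2

lemma K_deriv (n : ℕ) (x : ℝ) : HasDerivAt (K n) (-(be n * (psiH (n-1) x * psiH n x))) x := by
  induction n with
  | zero =>
    have : K 0 = fun _ => 0 := by funext y; simp [K]
    rw [this, be_zero]; simpa using hasDerivAt_const x (0:ℝ)
  | succ n ih =>
    have : K (n+1) = fun y => K n y + psiH n y ^ 2 := by
      funext y; simp [K, Finset.sum_range_succ]
    rw [this]
    refine (ih.add ((psi_deriv n x).pow 2)).congr_deriv ?_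
    simp; ring

lemma K_bound (n : ℕ) (x : ℝ) : K n x ≤ be n := by
  have hK : Integrable (K n) := integrable_finsetSum _ fun k _ => by
    simpa [sq] using G_int k k
  have hi : Integrable (fun x => -(be n * (psiH (n-1) x * psiH n x))) :=
    ((G_int _ _).const_mul _).neg
  have ht := tendsto_zero_of_hasDerivAt_of_integrableOn_Iic (a := x) (fun y _ => K_deriv n y)
    hi.integrableOn hK.integrableOn
  have h := integral_Iic_of_hasDerivAt_of_tendsto' (a := x) (fun y _ => K_deriv n y)
    hi.integrableOn ht
  rw [sub_zero] at h
  rw [← h]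
  have hb : 0 ≤ be n := Real.sqrt_nonneg _
  have hj : Integrable (fun x => be n * ((psiH (n-1) x * psiH (n-1) x + psiH n x * psiH n x) / 2)) :=
    (((G_int _ _).add (G_int _ _)).div_const 2).const_mul _
  calc _ ≤ ∫ x in Set.Iic x, be n * ((psiH (n-1) x * psiH (n-1) x + psiH n x * psiH n x) / 2) := by
        refine integral_mono hi.integrableOn hj.integrableOn fun y => ?_
        have : -(psiH (n-1) y * psiH n y) ≤
          (psiH (n-1) y * psiH (n-1) y + psiH n y * psiH n y) / 2 := by
          nlinarith [sq_nonneg (psiH (n-1) y + psiH n y)]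
        have := mul_le_mul_of_nonneg_left this hb
        simp only; linarith
    _ ≤ ∫ x, be n * ((psiH (n-1) x * psiH (n-1) x + psiH n x * psiH n x) / 2) := by
        refine setIntegral_le_integral hj (Eventually.of_forall fun y => ?_)
        simp only [Pi.zero_apply]
        exact mul_nonneg hb (by nlinarith [sq_nonneg (psiH (n-1) y), sq_nonneg (psiH n y)])
    _ = be n := by
        rw [integral_const_mul, integral_div, integral_add (G_int _ _) (G_int _ _)]
        have h1 := G_eq (n-1) (n-1)
        have h2 := G_eq n n
        unfold G at h1 h2
        rw [h1, h2]; simp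

lemma mem_sum (n : ℕ) (P : ℝ → ℝ) (hP : P ∈ PiH n) :
    ∃ a : ℕ → ℝ, P = fun x => ∑ k ∈ Finset.range n, a k * psiH k x := by
  unfold PiH at hP
  induction hP using Submodule.span_induction with
  | mem f hf =>
    obtain ⟨k, hk, rfl⟩ := hf
    refine ⟨fun j => if j = k then 1 else 0, ?_⟩
    funext x
    simp [hk]
  | zero => exact ⟨fun _ => 0, by funext x; simp⟩
  | add f h _ _ h1 h2 =>
    obtain ⟨a, rfl⟩ := h1
    obtain ⟨b, rfl⟩ := h2
    exact ⟨fun k => a k + b k, by funext x; simp [add_mul, Finset.sum_add_distrib]⟩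
  | smul r f _ h1 =>
    obtain ⟨a, rfl⟩ := h1
    exact ⟨fun k => r * a k, by funext x; simp [Finset.mul_sum, mul_assoc]⟩

lemma sup_bound (n : ℕ) (a : ℕ → ℝ) (x : ℝ) :
    (∑ k ∈ Finset.range n, a k * psiH k x)^2 ≤
      be n * ∫ y, (∑ k ∈ Finset.range n, a k * psiH k y)^2 := by
  have h := int_sum_sq n 0 a
  simp only [add_zero] at h
  rw [h, mul_comm]
  refine (Finset.sum_mul_sq_le_sq_mul_sq _ _ _).trans ?_
  exact mul_le_mul_of_nonneg_left (K_bound n x) (Finset.sum_nonneg fun _ _ => sq_nonneg _)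

lemma x_bound (n : ℕ) (a : ℕ → ℝ) :
    ∫ x, (x * ∑ k ∈ Finset.range n, a k * psiH k x)^2 ≤
      2 * n * ∫ y, (∑ k ∈ Finset.range n, a k * psiH k y)^2 := by
  rcases n with _ | m
  · simp
  set U : ℝ → ℝ := fun x => ∑ k ∈ Finset.range (m+1), (a k * (be (k+1) / 2)) * psiH (k+1) x with hU
  set D : ℝ → ℝ := fun x => ∑ k ∈ Finset.range m, (a (k+1) * (be (k+1) / 2)) * psiH (k+0) x with hD
  have hUP : PG U := PG.sum _ _ _
  have hDP : PG D := PG.sum _ _ _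
  have e : ∀ x, (x * ∑ k ∈ Finset.range (m+1), a k * psiH k x) = U x + D x := by
    intro x
    have : ∀ k ∈ Finset.range (m+1), x * (a k * psiH k x) =
        (a k * (be (k+1) / 2)) * psiH (k+1) x + (a k * (be k / 2)) * psiH (k-1) x := by
      intro k _
      linear_combination a k * psi_x k x
    rw [Finset.mul_sum, Finset.sum_congr rfl this, Finset.sum_add_distrib]
    congr 1
    rw [Finset.sum_range_succ', be_zero]
    simp [hD]
  have h := int_sum_sq (m+1) 0 a
  simp only [add_zero] at h
  have iU : Integrable (fun x => U x ^ 2) := by simpa [sq] using hUP.int_mul hUP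
  have iD : Integrable (fun x => D x ^ 2) := by simpa [sq] using hDP.int_mul hDP
  have hf : PG (fun x => ∑ k ∈ Finset.range (m+1), a k * psiH k x) := PG.sum _ _ _
  rw [h]
  calc _ ≤ ∫ x, (2 * U x ^ 2 + 2 * D x ^ 2) := by
        refine integral_mono (by simpa [sq] using hf.xmul.int_mul hf.xmul)
          ((iU.const_mul 2).add (iD.const_mul 2)) fun x => ?_
        simp only [e]
        nlinarith [sq_nonneg (U x - D x)]
    _ = 2 * ∑ k ∈ Finset.range (m+1), (a k * (be (k+1) / 2))^2 +
        2 * ∑ k ∈ Finset.range m, (a (k+1) * (be (k+1) / 2))^2 := by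
        rw [integral_add (iU.const_mul 2) (iD.const_mul 2), integral_const_mul, integral_const_mul,
          int_sum_sq, int_sum_sq]
    _ ≤ 2 * ∑ k ∈ Finset.range (m+1), ((m+1:ℝ)/2) * a k ^2 +
        2 * ∑ k ∈ Finset.range m, ((m+1:ℝ)/2) * a (k+1)^2 := by
        have key : ∀ (k : ℕ) (t : ℝ), k ≤ m → (t * (be (k+1)/2))^2 ≤ ((m+1:ℝ)/2) * t^2 := by
          intro k t hk
          have h1 := be_sq (k+1)
          have h2 : (t * (be (k+1)/2))^2 = t^2 * ((k+1:ℝ)/2) := by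
            push_cast at h1
            linear_combination t^2/4 * h1
          have h3 : (k:ℝ) ≤ m := by exact_mod_cast hk
          rw [h2]
          nlinarith [sq_nonneg t]
        gcongr with k hk k hk
        · exact key k _ (by simp at hk; omega)
        · exact key k _ (by simp at hk; omega)
    _ ≤ _ := by
        rw [← Finset.mul_sum, ← Finset.mul_sum]
        have : ∑ k ∈ Finset.range m, a (k+1)^2 ≤ ∑ k ∈ Finset.range (m+1), a k ^2 := by
          rw [Finset.sum_range_succ']; nlinarith [sq_nonneg (a 0)]
        have := mul_le_mul_of_nonneg_left this (show (0:ℝ) ≤ (m+1) by positivity)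
        push_cast; linarith

lemma int_w (n : ℕ) (hn : 1 ≤ n) : Integrable (fun x : ℝ => ((n:ℝ) + x^2)⁻¹) ∧
    ∫ x : ℝ, ((n:ℝ) + x^2)⁻¹ = Real.pi / Real.sqrt n := by
  have hn' : (0:ℝ) < n := by exact_mod_cast hn
  have hs : 0 < Real.sqrt n := Real.sqrt_pos.mpr hn'
  have hss : Real.sqrt n ^ 2 = n := Real.sq_sqrt hn'.le
  have e : (fun x : ℝ => ((n:ℝ) + x^2)⁻¹) =
      fun x => (n:ℝ)⁻¹ * (fun y : ℝ => (1 + y^2)⁻¹) (x / Real.sqrt n) := by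
    funext x
    simp only
    rw [← mul_inv, div_pow, hss]
    congr 1; field_simp
  rw [e]
  constructor
  · exact (integrable_inv_one_add_sq.comp_div hs.ne').const_mul _
  · rw [integral_const_mul, Measure.integral_comp_div (fun y : ℝ => (1 + y^2)⁻¹),
      integral_univ_inv_one_add_sq, abs_of_pos hs, smul_eq_mul]
    field_simp
    rw [hss]

end Nik

theorem stmt15 :
    ∃ c : ℝ, 0 < c ∧ ∀ (n : ℕ), 1 ≤ n → ∀ P : ℝ → ℝ, P ∈ PiH n →
      eLpNorm P 1 volume ≤ ENNReal.ofReal (c * Real.sqrt n) * eLpNorm P ⊤ volume ∧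
        ENNReal.ofReal (Real.sqrt n) * eLpNorm P ⊤ volume ≤
          ENNReal.ofReal (c * n) * eLpNorm P 1 volume := by
  refine ⟨3 * Real.pi, by positivity, fun n hn P hP => ?_⟩
  obtain ⟨a, ha⟩ := Nik.mem_sum n P hP
  have hPG : Nik.PG P := ha ▸ Nik.PG.sum n a id
  have hn' : (0:ℝ) < n := by exact_mod_cast hn
  have hs : 0 < Real.sqrt n := Real.sqrt_pos.mpr hn'
  have hss : Real.sqrt n * Real.sqrt n = n := Real.mul_self_sqrt hn'.le
  have hsup : ∀ x, P x ^ 2 ≤ Nik.be n * ∫ y, P y ^ 2 := by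
    rw [ha]; exact Nik.sup_bound n a
  have hx : ∫ x, (x * P x)^2 ≤ 2 * n * ∫ y, P y ^ 2 := by
    rw [ha]; exact Nik.x_bound n a
  have i1 : Integrable P := hPG.int
  have i2 : Integrable (fun x => P x ^ 2) := by simpa [sq] using hPG.int_mul hPG
  have ix : Integrable (fun x => (x * P x) ^ 2) := by
    simpa [sq] using hPG.xmul.int_mul hPG.xmul
  set N2 := ∫ y, P y ^ 2 with hN2
  set N1 := ∫ y, |P y| with hN1
  have hN10 : 0 ≤ N1 := integral_nonneg fun _ => abs_nonneg _
  have e1 : eLpNorm P 1 volume = ENNReal.ofReal N1 := by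
    rw [eLpNorm_one_eq_lintegral_enorm, hN1, ← ofReal_integral_norm_eq_lintegral_enorm i1]
    simp [Real.norm_eq_abs]
  have hfin : eLpNorm P ⊤ volume ≤ ENNReal.ofReal (Real.sqrt (Nik.be n * N2)) := by
    have := eLpNormEssSup_le_of_ae_bound (f := P) (μ := volume) (C := Real.sqrt (Nik.be n * N2))
      (Eventually.of_forall fun x => by
        rw [Real.norm_eq_abs]; exact Real.abs_le_sqrt (hsup x))
    simpa [eLpNorm_exponent_top] using this
  have hne : eLpNorm P ⊤ volume ≠ ⊤ := ne_top_of_le_ne_top ofReal_ne_top hfin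
  set M := (eLpNorm P ⊤ volume).toReal with hM
  have hM0 : 0 ≤ M := toReal_nonneg
  have e2 : eLpNorm P ⊤ volume = ENNReal.ofReal M := (ofReal_toReal hne).symm
  have hae : ∀ᵐ x, |P x| ≤ M := by
    have := ae_le_eLpNormEssSup (f := P) (μ := volume)
    filter_upwards [this] with x hx
    rw [← eLpNorm_exponent_top, e2, ← ofReal_norm] at hx
    exact (ofReal_le_ofReal_iff hM0).mp hx
  have h21 : N2 ≤ M * N1 := by
    rw [hN2, hN1, ← integral_const_mul]
    refine integral_mono_ae i2 (i1.abs.const_mul M) ?_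
    filter_upwards [hae] with x hx
    rw [← sq_abs, sq]
    exact mul_le_mul_of_nonneg_right hx (abs_nonneg _)
  have hN20 : 0 ≤ N2 := integral_nonneg fun _ => sq_nonneg _
  have hbe : 0 ≤ Nik.be n := Real.sqrt_nonneg _
  have hMs : M ^ 2 ≤ Nik.be n * N2 := by
    have h : M ≤ Real.sqrt (Nik.be n * N2) := by
      rw [e2] at hfin
      exact (ofReal_le_ofReal_iff (Real.sqrt_nonneg _)).mp hfin
    calc M^2 ≤ Real.sqrt (Nik.be n * N2) ^ 2 := by gcongr
      _ = _ := Real.sq_sqrt (by positivity)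
  have hpi := Real.pi_gt_three
  rw [e1, e2]
  constructor
  · rw [← ofReal_mul (by positivity)]
    apply ofReal_le_ofReal
    rcases hM0.eq_or_lt with h0 | h0
    · have : N1 = 0 := by
        rw [hN1]
        apply integral_eq_zero_of_ae
        filter_upwards [hae] with x hx
        rw [← h0] at hx
        exact le_antisymm hx (abs_nonneg _)
      rw [this]; positivity
    · obtain ⟨iw, hw⟩ := Nik.int_w n hn
      set l : ℝ := 1 / (3 * n * M) with hl
      have hl0 : 0 < l := by positivity
      have ia : Integrable (fun x => l / 2 * (n * P x ^ 2 + (x * P x)^2)) :=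
        ((i2.const_mul _).add ix).const_mul _
      have ib : Integrable (fun x : ℝ => 1 / (2 * l) * ((n:ℝ) + x^2)⁻¹) := iw.const_mul _
      have h1 : N1 ≤ ∫ x, (l / 2 * (n * P x ^ 2 + (x * P x)^2) + 1 / (2 * l) * ((n:ℝ) + x^2)⁻¹) := by
        refine integral_mono i1.abs (ia.add ib) fun x => ?_
        have hw0 : 0 < (n:ℝ) + x^2 := by positivity
        have h3 : l / 2 * (n * P x ^ 2 + (x * P x)^2) + 1 / (2 * l) * ((n:ℝ) + x^2)⁻¹ - |P x|
            = (l * (n + x^2) * |P x| - 1)^2 / (2 * l * (n + x^2)) := by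
          field_simp
          rw [← sq_abs (P x)]
          ring
        have h4 : 0 ≤ (l * (n + x^2) * |P x| - 1)^2 / (2 * l * (n + x^2)) := by positivity
        simp only
        linarith
      rw [integral_add ia ib, integral_const_mul, integral_const_mul,
        integral_add (i2.const_mul _) ix, integral_const_mul, hw] at h1
      have h5 : l / 2 * (n * N2 + ∫ x, (x * P x)^2) ≤ N1 / 2 := by
        calc _ ≤ l / 2 * (n * (M * N1) + 2 * n * (M * N1)) := by
              gcongr
              exact hx.trans (by gcongr)
          _ = N1 / 2 := by rw [hl]; field_simp; ring
      have h6 : 1 / (2 * l) * (Real.pi / Real.sqrt n) = 3 * Real.pi * Real.sqrt n * M / 2 := by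
        rw [hl]; field_simp; rw [sq, hss]
      linarith
  · rw [← ofReal_mul (by positivity), ← ofReal_mul (by positivity)]
    apply ofReal_le_ofReal
    have hb2 : Nik.be n ≤ 2 * Real.sqrt n := by
      unfold Nik.be
      rw [Real.sqrt_le_left (by positivity)]
      nlinarith
    have h7 : M ≤ Nik.be n * N1 := by
      rcases hM0.eq_or_lt with h0 | h0
      · rw [← h0]; positivity
      · have : M * M ≤ M * (Nik.be n * N1) := by nlinarith
        exact le_of_mul_le_mul_left this h0
    calc Real.sqrt n * M ≤ Real.sqrt n * (2 * Real.sqrt n * N1) := by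
          gcongr; exact h7.trans (by gcongr)
      _ = 2 * n * N1 := by linear_combination 2 * N1 * hss
      _ ≤ 3 * Real.pi * n * N1 := by gcongr; linarith
end
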